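/- arXiv:2312.07205 — 2 statements merged into one kernel-verified Lean document; each statement's English description precedes it below -/
import Mathlib

section
/- Let c > 0, ν > 0, β = c/ν, let g be the Green's function of the 1D advection–diffusion problem, let f : [0,1] → ℝ be continuous, and define u(x) = ∫₀¹ g(x,s) f(s) ds. Then u is twice continuously differentiable on [0,1], satisfies c·u'(x) − ν·u''(x) = f(x) for every x ∈ (0,1), and u(0) = u(1) = 0. -/
open Set intervalIntegral Real

/-- For a kernel that splits as `a x * p s` for `s < x` and `b x * q s` for `x ≤ s`, the integral
over `[0,1]` splits at `x`. -/
theorem integral_split_kernel (g : ℝ → ℝ → ℝ) (a b p q f F : ℝ → ℝ)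
    (hp : Continuous p) (hq : Continuous q) (hF : Continuous F)
    (hle : ∀ x s, x ≤ s → g x s = b x * q s) (hgt : ∀ x s, s < x → g x s = a x * p s)
    (hfF : ∀ s ∈ Icc (0:ℝ) 1, f s = F s) {x : ℝ} (hx : x ∈ Icc (0:ℝ) 1) :
    ∫ s in (0:ℝ)..1, g x s * f s =
      a x * (∫ s in (0:ℝ)..x, p s * F s) + b x * (∫ s in x..1, q s * F s) := by
  have hleft : EqOn (fun s => a x * (p s * F s)) (fun s => g x s * f s) (uIoo 0 x) := by
    intro s hs
    rw [uIoo_of_le hx.1] at hs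
    simp only [hgt x s hs.2, hfF s ⟨hs.1.le, hs.2.le.trans hx.2⟩]
    ring
  have hright : EqOn (fun s => b x * (q s * F s)) (fun s => g x s * f s) (uIoo x 1) := by
    intro s hs
    rw [uIoo_of_le hx.2] at hs
    simp only [hle x s hs.1.le, hfF s ⟨hx.1.trans hs.1.le, hs.2.le⟩]
    ring
  have ileft : IntervalIntegrable (fun s => a x * (p s * F s)) MeasureTheory.volume 0 x :=
    (continuous_const.mul (hp.mul hF)).intervalIntegrable _ _
  have iright : IntervalIntegrable (fun s => b x * (q s * F s)) MeasureTheory.volume x 1 :=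
    (continuous_const.mul (hq.mul hF)).intervalIntegrable _ _
  rw [← integral_add_adjacent_intervals (ileft.congr_uIoo hleft) (iright.congr_uIoo hright),
    ← integral_congr_uIoo hleft, ← integral_congr_uIoo hright,
    intervalIntegral.integral_const_mul, intervalIntegral.integral_const_mul]

/-- Applying the Green's function of the 1D advection–diffusion problem
`c·u' − ν·u'' = f` (with `β = c/ν`) to a continuous source `f` yields a twice
continuously differentiable function on `[0,1]` which satisfies the equation on
`(0,1)` and the homogeneous Dirichlet boundary conditions. -/
theorem advection_diffusion_green_solves
    (c ν : ℝ) (hc : 0 < c) (hν : 0 < ν) (β : ℝ) (hβ : β = c / ν)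
    (g : ℝ → ℝ → ℝ)
    (hg : ∀ x s, g x s =
      if x ≤ s then
        (Real.exp (β * x) - 1) * (Real.exp (-β * s) - Real.exp (-β))
          / (c * (1 - Real.exp (-β)))
      else
        (1 - Real.exp (-β * (1 - x))) * (1 - Real.exp (-β * s))
          / (c * (1 - Real.exp (-β))))
    (f : ℝ → ℝ) (hf : ContinuousOn f (Icc 0 1))
    (u : ℝ → ℝ) (hu : ∀ x, u x = ∫ s in (0:ℝ)..1, g x s * f s) :
    ∃ u' u'' : ℝ → ℝ,
      (∀ x ∈ Icc (0:ℝ) 1, HasDerivWithinAt u (u' x) (Icc 0 1) x) ∧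
      ContinuousOn u' (Icc 0 1) ∧
      (∀ x ∈ Icc (0:ℝ) 1, HasDerivWithinAt u' (u'' x) (Icc 0 1) x) ∧
      ContinuousOn u'' (Icc 0 1) ∧
      (∀ x ∈ Ioo (0:ℝ) 1, c * u' x - ν * u'' x = f x) ∧
      u 0 = 0 ∧ u 1 = 0 := by
  have hβ0 : 0 < β := hβ ▸ div_pos hc hν
  have hcν : c = β * ν := by rw [hβ]; field_simp
  have hq1 : 1 - exp (-β) ≠ 0 := by
    have : exp (-β) < 1 := Real.exp_lt_one_iff.2 (by linarith)
    linarith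
  set K : ℝ := c * (1 - exp (-β)) with hK
  set F : ℝ → ℝ := IccExtend zero_le_one ((Icc (0:ℝ) 1).domRestrict f) with hFdef
  have hF : Continuous F := (continuousOn_iff_continuous_domRestrict.1 hf).Icc_extend'
  have hfF : ∀ s ∈ Icc (0:ℝ) 1, f s = F s := fun s hs => by
    rw [hFdef, IccExtend_of_mem _ _ hs, domRestrict_apply]
  have hpc : Continuous fun s => 1 - exp (-β * s) := by fun_prop
  have hqc : Continuous fun s => exp (-β * s) - exp (-β) := by fun_prop
  set A : ℝ → ℝ := fun x => ∫ s in (0:ℝ)..x, (1 - exp (-β * s)) * F s with hAdef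
  set B : ℝ → ℝ := fun x => ∫ s in x..1, (exp (-β * s) - exp (-β)) * F s with hBdef
  have hA : ∀ x, HasDerivAt A ((1 - exp (-β * x)) * F x) x := fun x =>
    (hpc.mul hF).integral_hasStrictDerivAt 0 x |>.hasDerivAt
  have hB : ∀ x, HasDerivAt B (-((exp (-β * x) - exp (-β)) * F x)) x := fun x =>
    integral_hasDerivAt_left ((hqc.mul hF).intervalIntegrable _ _)
      ((hqc.mul hF).stronglyMeasurableAtFilter _ _) (hqc.mul hF).continuousAt
  have hE : ∀ x, HasDerivAt (fun x => exp (β * x)) (β * exp (β * x)) x := fun x => by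
    simpa [mul_comm] using ((hasDerivAt_id x).const_mul β).exp
  have hinv : ∀ x, exp (β * x) * exp (-β * x) = 1 := fun x => by
    rw [← exp_add]; simp
  have hU : ∀ x ∈ Icc (0:ℝ) 1,
      u x = ((1 - exp (-β) * exp (β * x)) * A x + (exp (β * x) - 1) * B x) / K := by
    intro x hx
    rw [hu, integral_split_kernel g (fun x => (1 - exp (-β * (1 - x))) / K)
      (fun x => (exp (β * x) - 1) / K) _ _ f F hpc hqc hF _ _ hfF hx, ← exp_add,
      show -β + β * x = -β * (1 - x) by ring]
    · ring
    · intro x s h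
      rw [hg, if_pos h]
      ring
    · intro x s h
      rw [hg, if_neg h.not_ge]
      ring
  have hU' : ∀ x, HasDerivAt
      (fun x => ((1 - exp (-β) * exp (β * x)) * A x + (exp (β * x) - 1) * B x) / K)
      (β * exp (β * x) * (B x - exp (-β) * A x) / K) x := by
    intro x
    have h := (((((hE x).const_mul (exp (-β))).const_sub 1).mul (hA x)).add
      (((hE x).sub_const 1).mul (hB x))).div_const K
    refine h.congr_deriv ?_
    congr 1
    linear_combination (exp (-β) - 1) * F x * hinv x
  have hU'' : ∀ x, HasDerivAt
      (fun x => β * exp (β * x) * (B x - exp (-β) * A x) / K)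
      (β * (β * exp (β * x) * (B x - exp (-β) * A x) / K) - F x / ν) x := by
    intro x
    have h := ((((hE x).const_mul β).mul ((hB x).sub ((hA x).const_mul (exp (-β)))))).div_const K
    refine h.congr_deriv ?_
    have hFK : F x / ν = β * (1 - exp (-β)) * F x / K := by
      rw [hK, hcν]
      field_simp
    rw [hFK]
    simp only [Pi.sub_apply]
    linear_combination (-(β * (1 - exp (-β)) * F x / K)) * hinv x
  have hcont := continuous_iff_continuousAt.2 fun x => (hU'' x).continuousAt
  refine ⟨_, _, fun x hx => (hU' x).hasDerivWithinAt.congr hU (hU x hx), hcont.continuousOn,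
    fun x _ => (hU'' x).hasDerivWithinAt,
    ((continuous_const.mul hcont).sub (hF.div_const ν)).continuousOn, fun x hx => ?_, ?_, ?_⟩
  · rw [hfF x (Ioo_subset_Icc_self hx), hcν]
    field_simp
    ring
  · rw [hU 0 (by simp)]
    simp [hAdef]
  · rw [hU 1 (by simp)]
    simp [hBdef, ← exp_add]
end

section
/- Let V and W be real vector spaces, k ∈ ℕ, and let G : W →ₗ V, μ : V →ₗ (Fin k → ℝ), and ι : (Fin k → ℝ) →ₗ W be linear maps. Suppose M = μ ∘ G ∘ ι has a two-sided linear inverse N. Then the operator P = (G ∘ ι) ∘ N ∘ μ : V →ₗ V is idempotent (P ∘ P = P), its range equals the range of G ∘ ι, and the fine-scale Green's operator satisfies G' = (id − P) ∘ G. Consequently, for every w ∈ W, G(w) decomposes as G(w) = G'(w) + P(G(w)), where P(G(w)) lies in the resolved space spanned by the 𝒢μᵢ and μ(G'(w)) = 0. -/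
/-- With `N` a two-sided inverse of `M = μ∘G∘ι`, the operator
`P = (G∘ι)∘N∘μ` is idempotent, its range equals the range of `G∘ι`, the
fine-scale Green's operator satisfies `G' = (id − P)∘G`, and every `G w`
decomposes as `G w = G' w + P (G w)` with `P (G w)` in the resolved space
(the range of `G∘ι`) and `μ (G' w) = 0`. -/
theorem fine_scale_green_decomposition
    (V W : Type*) [AddCommGroup V] [Module ℝ V] [AddCommGroup W] [Module ℝ W]
    (k : ℕ)
    (G : W →ₗ[ℝ] V) (μ : V →ₗ[ℝ] (Fin k → ℝ)) (ι : (Fin k → ℝ) →ₗ[ℝ] W)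
    (N : (Fin k → ℝ) →ₗ[ℝ] (Fin k → ℝ))
    (hNM : N ∘ₗ (μ ∘ₗ G ∘ₗ ι) = LinearMap.id)
    (hMN : (μ ∘ₗ G ∘ₗ ι) ∘ₗ N = LinearMap.id)
    (P : V →ₗ[ℝ] V) (hP : P = (G ∘ₗ ι) ∘ₗ N ∘ₗ μ)
    (G' : W →ₗ[ℝ] V) (hG' : G' = G - ((G ∘ₗ ι) ∘ₗ N ∘ₗ μ ∘ₗ G)) :
    P ∘ₗ P = P ∧
    LinearMap.range P = LinearMap.range (G ∘ₗ ι) ∧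
    G' = (LinearMap.id - P) ∘ₗ G ∧
    ∀ w : W,
      G w = G' w + P (G w) ∧
      P (G w) ∈ LinearMap.range (G ∘ₗ ι) ∧
      μ (G' w) = 0 := by
  subst hP hG'
  have hN (x) : N (μ (G (ι x))) = x := LinearMap.congr_fun hNM x
  have hM (x) : μ (G (ι (N x))) = x := LinearMap.congr_fun hMN x
  refine ⟨?_, le_antisymm (LinearMap.range_comp_le_range _ _) ?_, ?_, fun w => ⟨?_, ?_, ?_⟩⟩
  · refine LinearMap.ext fun v => ?_
    simp [hM]
  · rintro _ ⟨x, rfl⟩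
    exact ⟨G (ι x), by simp [hN]⟩
  · refine LinearMap.ext fun w => ?_
    simp
  · simp
  · exact ⟨N (μ (G w)), rfl⟩
  · simp [hM]
end
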